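/- arXiv:2510.11441 — 2 statements merged into one kernel-verified Lean document; each statement's English description precedes it below -/
import Mathlib

section
/- For every (a,b) in the hyperbolic set H, both points 0 and 1/2 of ℝ/ℤ belong to the immediate basin of attraction of the attracting periodic orbit of f_{a,b}. -/
open Set Filter Topology

noncomputable section

/-- Representative of a point of the circle in `[0,1)`. -/
noncomputable def rep (z : UnitAddCircle) : ℝ := (AddCircle.equivIco 1 0 z).val

/-- The straight sine map on `[0,1)`. -/
noncomputable def Sfun (t : ℝ) : ℝ := if t ≤ 1/2 then 4*t - 1 else -4*t + 3

/-- The piecewise linear perturbation of the doubling map. -/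
noncomputable def plpdm (a : UnitAddCircle) (b : ℝ) (z : UnitAddCircle) : UnitAddCircle :=
  ((2 * rep z + (b/2) * Sfun (rep z) : ℝ) : UnitAddCircle) + a

/-- The doubling map. -/
def Dbl (z : UnitAddCircle) : UnitAddCircle := z + z

/-- `x` is an attracting periodic point of `f` of exact period `n`. -/
def IsAttractingPeriodicPt (f : UnitAddCircle → UnitAddCircle) (n : ℕ)
    (x : UnitAddCircle) : Prop :=
  0 < n ∧ f^[n] x = x ∧ (∀ m, 0 < m → m < n → f^[m] x ≠ x) ∧
  ∃ U : Set UnitAddCircle, IsOpen U ∧ IsConnected U ∧ x ∈ U ∧ f^[n] '' U ⊆ U ∧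
    ∀ y ∈ U, Tendsto (fun k => f^[n*k] y) atTop (nhds x)

/-- Forward orbit of `x` under `f`. -/
def orbitSet (f : UnitAddCircle → UnitAddCircle) (x : UnitAddCircle) : Set UnitAddCircle :=
  {y | ∃ i, f^[i] x = y}

/-- Basin of attraction of the set `O`. -/
def basin (f : UnitAddCircle → UnitAddCircle) (O : Set UnitAddCircle) : Set UnitAddCircle :=
  {y | Tendsto (fun k => Metric.infDist (f^[k] y) O) atTop (nhds 0)}

/-- Immediate basin of attraction of the orbit `O`. -/
def immBasin (f : UnitAddCircle → UnitAddCircle) (O : Set UnitAddCircle) :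
    Set UnitAddCircle :=
  ⋃ z ∈ O, connectedComponentIn (basin f O) z

/-- The hyperbolic set `H`. -/
def hypSet : Set (UnitAddCircle × ℝ) :=
  {q | q.2 ∈ Set.Ico (0:ℝ) 1 ∧ ∃ n x, IsAttractingPeriodicPt (plpdm q.1 q.2) n x}

/-- The lift `F_{a,b}` of `f_{a,b}`, normalized so that `F_{a,b}(0) ∈ [0,1)`. -/
noncomputable def liftF (a : UnitAddCircle) (b : ℝ) (x : ℝ) : ℝ :=
  (2 * Int.fract x + rep a + (b/2) * Sfun (Int.fract x)
    + (if rep a - b/2 < 0 then 1 else 0)) + 2 * (⌊x⌋ : ℝ)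

/-- `Φ_{a,b}`, the limit of `F_{a,b}^n(x)/2^n`. -/
noncomputable def Phi (a : UnitAddCircle) (b : ℝ) (x : ℝ) : ℝ :=
  limUnder atTop (fun n : ℕ => (liftF a b)^[n] x / 2 ^ n)

/-- The semiconjugacy `φ_{a,b}` induced by `Φ_{a,b}`. -/
noncomputable def phiMap (a : UnitAddCircle) (b : ℝ) (z : UnitAddCircle) : UnitAddCircle :=
  ((Phi a b (rep z) : ℝ) : UnitAddCircle)

/-- The arc `I₊ = [0,1/2]` of the circle. -/
def Iplus : Set UnitAddCircle := (fun t : ℝ => (t : UnitAddCircle)) '' Set.Icc 0 (1/2)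

/-- The arc `I₋ = [1/2,1]` of the circle. -/
def Iminus : Set UnitAddCircle := (fun t : ℝ => (t : UnitAddCircle)) '' Set.Icc (1/2) 1

/-- The orbit of `x` (of period `p`) avoids `0`, `1/2` and has slope itinerary `σ`,
where `σ j = true` encodes the symbol `−` and `σ j = false` encodes `+`. -/
def HasItinerary (f : UnitAddCircle → UnitAddCircle) (p : ℕ) (x : UnitAddCircle)
    (σ : Fin p → Bool) : Prop :=
  (∀ j : Fin p, f^[(j : ℕ)] x ≠ (0 : UnitAddCircle) ∧
      f^[(j : ℕ)] x ≠ (((1:ℝ)/2 : ℝ) : UnitAddCircle)) ∧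
  ∀ j : Fin p, (σ j = true → f^[(j : ℕ)] x ∈ Iminus) ∧ (σ j = false → f^[(j : ℕ)] x ∈ Iplus)

/-- The set `P_σ` of parameters whose attracting orbit has slope itinerary `σ`. -/
def paramSet (p : ℕ) (σ : Fin p → Bool) : Set (UnitAddCircle × ℝ) :=
  {q | q.2 ∈ Set.Ico (0:ℝ) 1 ∧ ∃ x, IsAttractingPeriodicPt (plpdm q.1 q.2) p x ∧
       HasItinerary (plpdm q.1 q.2) p x σ}

/-- `S` is a tongue: its closure meets `ℝ/ℤ × {1}` in a nondegenerate interval. -/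
def IsTongue (S : Set (UnitAddCircle × ℝ)) : Prop :=
  ∃ u v : ℝ, u < v ∧ ∀ t ∈ Set.Icc u v, (((t : ℝ) : UnitAddCircle), (1:ℝ)) ∈ closure S

end


/-- The points whose orbit under `G` converges to `X`. -/
def realBasin (G : ℝ → ℝ) (X : ℝ) : Set ℝ := {y | Tendsto (fun k => G^[k] y) atTop (𝓝 X)}

theorem mem_realBasin_iterate_iff {G : ℝ → ℝ} {X y : ℝ} (k : ℕ) :
    G^[k] y ∈ realBasin G X ↔ y ∈ realBasin G X := by
  simp only [realBasin, mem_ofPred_eq, ← Function.iterate_add_apply]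
  exact tendsto_add_atTop_iff_nat (f := fun j => G^[j] y) k

theorem ordConnected_realBasin {G : ℝ → ℝ} (hG : Monotone G) (X : ℝ) :
    (realBasin G X).OrdConnected :=
  ⟨fun _ hu _ hv _ hy => tendsto_of_tendsto_of_tendsto_of_le_of_le hu hv
    (fun k => hG.iterate k hy.1) (fun k => hG.iterate k hy.2)⟩

theorem realBasin_mem_nhds {G : ℝ → ℝ} (hG : Continuous G) {X y : ℝ}
    (hX : realBasin G X ∈ 𝓝 X) (hy : y ∈ realBasin G X) : realBasin G X ∈ 𝓝 y := by
  obtain ⟨k, hk⟩ := (Tendsto.eventually hy (interior_mem_nhds.2 hX)).exists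
  filter_upwards [(hG.iterate k).continuousAt.preimage_mem_nhds
    (isOpen_interior.mem_nhds hk)] with t ht
  exact (mem_realBasin_iterate_iff k).1 (interior_subset ht)

/-- The right end of the basin of an attracting fixed point is fixed. -/
theorem exists_fixed_right_end {G : ℝ → ℝ} (hG : Continuous G) (hmono : Monotone G) {X : ℝ}
    (hX : realBasin G X ∈ 𝓝 X) (hfix : G X = X) (hbdd : BddAbove (realBasin G X)) :
    ∃ q, X < q ∧ G q = q ∧ Ico X q ⊆ realBasin G X := by
  have hXW : X ∈ realBasin G X := mem_of_mem_nhds hX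
  have hlt : ∀ y ∈ realBasin G X, y < sSup (realBasin G X) := by
    intro y hy
    obtain ⟨t, ht, hyt⟩ := ((eventually_mem_set.2 (nhdsWithin_le_nhds (s := Ioi y)
      (realBasin_mem_nhds hG hX hy))).and self_mem_nhdsWithin).exists
    exact lt_of_lt_of_le hyt (le_csSup hbdd ht)
  set q := sSup (realBasin G X) with hq
  have hsub : Ico X q ⊆ realBasin G X := by
    intro y hy
    obtain ⟨t, ht, hyt⟩ := exists_lt_of_lt_csSup ⟨X, hXW⟩ hy.2
    exact (ordConnected_realBasin hmono X).out hXW ht ⟨hy.1, hyt.le⟩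
  refine ⟨q, hlt X hXW, le_antisymm ?_ ?_, hsub⟩
  · refine le_of_tendsto (hG.continuousAt.mono_left (nhdsWithin_le_nhds (s := Iio q))) ?_
    filter_upwards [Ioo_mem_nhdsLT (hlt X hXW)] with y hy
    exact (hlt _ ((mem_realBasin_iterate_iff 1).2 (hsub ⟨hy.1.le, hy.2⟩))).le
  · by_contra! hlt'
    have h1 : G q ∈ realBasin G X :=
      hsub ⟨by simpa [hfix] using hmono (hlt X hXW).le, hlt'⟩
    exact lt_irrefl _ (hlt q ((mem_realBasin_iterate_iff 1).1 h1))

theorem not_concaveOn_right_end {G : ℝ → ℝ} (hmono : Monotone G) {X q : ℝ} (hXq : X < q)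
    (hX : G X = X) (hq : G q = q) (hsub : Ico X q ⊆ realBasin G X) :
    ¬ ConcaveOn ℝ (Icc X q) G := by
  intro hc
  set y := (1 / 2 : ℝ) • X + (1 / 2 : ℝ) • q with hy
  have hle : y ≤ G y := by
    have := hc.2 (left_mem_Icc.2 hXq.le) (right_mem_Icc.2 hXq.le)
      (by norm_num : (0 : ℝ) ≤ 1 / 2) (by norm_num : (0 : ℝ) ≤ 1 / 2) (by norm_num)
    rwa [hX, hq] at this
  simp only [smul_eq_mul] at hy
  have hyW : y ∈ realBasin G X := hsub ⟨by linarith, by linarith⟩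
  have : y ≤ X := ge_of_tendsto' hyW fun k =>
    (monotone_nat_of_le_succ (f := fun k => G^[k] y) fun k => by
      rw [Function.iterate_succ_apply]; exact hmono.iterate k hle) (Nat.zero_le k)
  linarith

theorem concaveOn_iterate {F : ℝ → ℝ} (hF : Continuous F) (hmono : Monotone F) {u v : ℝ}
    (h : ∀ i, ∃ s, ConcaveOn ℝ s F ∧ F^[i] '' Icc u v ⊆ s) (n : ℕ) :
    ConcaveOn ℝ (Icc u v) F^[n] := by
  induction n with
  | zero => exact concaveOn_id (convex_Icc u v)
  | succ n ih =>
    obtain ⟨s, hs, hsub⟩ := h n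
    rw [Function.iterate_succ']
    have hconv : Convex ℝ (F^[n] '' Icc u v) :=
      (isPreconnected_Icc.image _ (hF.iterate n).continuousOn).ordConnected.convex
    exact (hs.subset hsub hconv).comp ih (hmono.monotoneOn _)

/-- If `F` is concave between consecutive points of `c + ℤ`, then some iterate of the basin of
an attracting fixed point of `F^[n] - m` meets `c + ℤ`. -/
theorem exists_iterate_mem_of_concaveOn {F : ℝ → ℝ} (hF : Continuous F) (hmono : StrictMono F)
    (c : ℝ) (hconc : ∀ k : ℤ, ConcaveOn ℝ (Icc (c + k) (c + k + 1)) F) (n : ℕ) (m X : ℝ)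
    (hX : F^[n] X = X + m) (hW : realBasin (fun t => F^[n] t - m) X ∈ 𝓝 X) :
    ∃ i, ∃ y ∈ realBasin (fun t => F^[n] t - m) X, ∃ k : ℤ, F^[i] y = c + k := by
  by_contra! hne
  set G : ℝ → ℝ := fun t => F^[n] t - m with hGdef
  have hG : Continuous G := (hF.iterate n).sub continuous_const
  have hGm : Monotone G := fun s t hst => sub_le_sub_right (hmono.monotone.iterate n hst) m
  have hfix : G X = X := by simp [hGdef, hX]
  have hXW := mem_of_mem_nhds hW
  have hbound : ∀ i, ∀ y ∈ realBasin G X, X ≤ y → F^[i] y < c + ⌊F^[i] X - c⌋ + 1 := by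
    intro i y hy hXy
    by_contra! hge
    have hmem : c + ⌊F^[i] X - c⌋ + 1 ∈ Icc (F^[i] X) (F^[i] y) :=
      ⟨by linarith [Int.lt_floor_add_one (F^[i] X - c)], hge⟩
    obtain ⟨t, ht, hte⟩ := intermediate_value_Icc hXy (hF.iterate i).continuousOn hmem
    refine hne i t ((ordConnected_realBasin hGm X).out hXW hy ht) (⌊F^[i] X - c⌋ + 1) ?_
    rw [hte]; push_cast; ring
  have hbdd : BddAbove (realBasin G X) := by
    refine ⟨c + ⌊X - c⌋ + 1, fun y hy => ?_⟩
    rcases le_total X y with hXy | hXy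
    · exact (hbound 0 y hy hXy).le
    · linarith [Int.lt_floor_add_one (X - c)]
  obtain ⟨q, hXq, hq, hsub⟩ := exists_fixed_right_end hG hGm hW hfix hbdd
  refine not_concaveOn_right_end hGm hXq hfix hq hsub ?_
  have := concaveOn_iterate hF hmono.monotone (u := X) (v := q)
    (fun i => ⟨_, hconc ⌊F^[i] X - c⌋, ?_⟩) n
  · exact this.sub (convexOn_const m (convex_Icc X q))
  · have hqle : F^[i] q ≤ c + ⌊F^[i] X - c⌋ + 1 := by
      refine le_of_tendsto
        ((hF.iterate i).continuousAt.mono_left (nhdsWithin_le_nhds (s := Iio q))) ?_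
      filter_upwards [Ioo_mem_nhdsLT hXq] with y hy
      exact (hbound i y (hsub ⟨hy.1.le, hy.2⟩) hy.1.le).le
    rintro _ ⟨t, ht, rfl⟩
    refine ⟨?_, (hmono.monotone.iterate i ht.2).trans hqle⟩
    have h1 : F^[i] X ≤ F^[i] t := hmono.monotone.iterate i ht.1
    linarith [Int.floor_le (F^[i] X - c)]

/-- Convex counterpart of `exists_iterate_mem_of_concaveOn`, obtained by conjugating with
`t ↦ -t`. -/
theorem exists_iterate_mem_of_convexOn {F : ℝ → ℝ} (hF : Continuous F) (hmono : StrictMono F)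
    (c : ℝ) (hconv : ∀ k : ℤ, ConvexOn ℝ (Icc (c + k) (c + k + 1)) F) (n : ℕ) (m X : ℝ)
    (hX : F^[n] X = X + m) (hW : realBasin (fun t => F^[n] t - m) X ∈ 𝓝 X) :
    ∃ i, ∃ y ∈ realBasin (fun t => F^[n] t - m) X, ∃ k : ℤ, F^[i] y = c + k := by
  set F' : ℝ → ℝ := fun t => -F (-t) with hF'
  have hiter : ∀ i t, F'^[i] t = -F^[i] (-t) := by
    intro i t
    have : Function.Semiconj (fun t : ℝ => -t) F F' := fun t => by simp [hF']
    simpa using (this.iterate_right i (-t)).symm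
  set G : ℝ → ℝ := fun t => F^[n] t - m with hG
  set G' : ℝ → ℝ := fun t => F'^[n] t - -m with hG'
  have hGiter : ∀ i t, G'^[i] (-t) = -G^[i] t := by
    intro i t
    have : Function.Semiconj (fun t : ℝ => -t) G G' := fun t => by
      simp only [hG, hG', hiter, neg_neg]; ring
    exact (this.iterate_right i t).symm
  have hmem : ∀ t, -t ∈ realBasin G' (-X) ↔ t ∈ realBasin G X := by
    intro t
    simp only [realBasin, mem_ofPred_eq, hGiter]
    exact ⟨fun h => by simpa using h.neg, fun h => h.neg⟩
  have hconc : ∀ k : ℤ, ConcaveOn ℝ (Icc (-c + k) (-c + k + 1)) F' := by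
    intro k
    have h1 := ((hconv (-k - 1)).comp_linearMap (-LinearMap.id)).neg
    have hs : (-LinearMap.id : ℝ →ₗ[ℝ] ℝ) ⁻¹' Icc (c + ((-k - 1 : ℤ) : ℝ))
        (c + ((-k - 1 : ℤ) : ℝ) + 1) = Icc (-c + k) (-c + k + 1) := by
      ext t
      simp only [mem_preimage, LinearMap.neg_apply, LinearMap.id_apply, mem_Icc]
      push_cast
      constructor <;> rintro ⟨h1, h2⟩ <;> constructor <;> linarith
    rw [hs] at h1
    exact h1
  obtain ⟨i, y, hy, k, hk⟩ := exists_iterate_mem_of_concaveOn (F := F')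
    (hF.comp continuous_neg).neg (fun s t hst => neg_lt_neg (hmono (neg_lt_neg hst)))
    (-c) hconc n (-m) (-X) (by rw [hiter, neg_neg, hX]; ring) (by
      have := continuous_neg.continuousAt.preimage_mem_nhds (x := -X) (by rwa [neg_neg])
      filter_upwards [this] with t ht
      have := (hmem (-t)).2 ht
      rwa [neg_neg] at this)
  refine ⟨i, -y, (hmem (-y)).1 (by rwa [neg_neg]), -k, ?_⟩
  rw [hiter] at hk
  push_cast
  linarith

/-- A lift of `plpdm A b` to the real line. -/
noncomputable def plLift (A b t : ℝ) : ℝ := 2 * t + A + (b / 2) * (4 * ‖(t : UnitAddCircle)‖ - 1)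

theorem coe_rep (z : UnitAddCircle) : ((rep z : ℝ) : UnitAddCircle) = z :=
  (AddCircle.equivIco 1 0).symm_apply_apply z

theorem coe_intCast_eq_zero (k : ℤ) : ((k : ℝ) : UnitAddCircle) = 0 := by
  rw [AddCircle.coe_eq_zero_iff]
  exact ⟨k, by simp⟩

theorem coe_add_intCast (t : ℝ) (k : ℤ) : ((t + k : ℝ) : UnitAddCircle) = t := by
  rw [AddCircle.coe_add, coe_intCast_eq_zero, add_zero]

theorem norm_coe_eq_abs_sub {t : ℝ} (k : ℤ) (h : |t - k| ≤ 1 / 2) :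
    ‖(t : UnitAddCircle)‖ = |t - k| := by
  have : (t : UnitAddCircle) = ((t - k : ℝ) : UnitAddCircle) := by
    rw [AddCircle.coe_sub]
    rw [coe_intCast_eq_zero, sub_zero]
  rw [this]
  exact (AddCircle.norm_coe_eq_abs_iff (p := (1 : ℝ)) one_ne_zero).2 (by simpa using h)

theorem norm_coe_eq_min {t : ℝ} (k : ℤ) (h : t ∈ Icc (k : ℝ) (k + 1)) :
    ‖(t : UnitAddCircle)‖ = min (t - k) (k + 1 - t) := by
  rcases le_total t (k + 1 / 2) with h1 | h1
  · have h2 : |t - k| = t - k := abs_of_nonneg (by linarith [h.1])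
    rw [norm_coe_eq_abs_sub k (by rw [h2]; linarith), h2, min_eq_left (by linarith)]
  · have h2 : |t - ((k + 1 : ℤ) : ℝ)| = k + 1 - t := by
      push_cast
      rw [abs_of_nonpos (by linarith [h.2])]; ring
    rw [norm_coe_eq_abs_sub (k + 1) (by rw [h2]; linarith), h2, min_eq_right (by linarith)]

theorem Sfun_rep (z : UnitAddCircle) : Sfun (rep z) = 4 * ‖z‖ - 1 := by
  have h := (AddCircle.equivIco 1 0 z).2
  change rep z ∈ Ico (0 : ℝ) (0 + 1) at h
  have h1 := norm_coe_eq_min (t := rep z) 0 ⟨by simpa using h.1, by simpa using h.2.le⟩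
  rw [coe_rep] at h1
  rw [h1, Sfun]
  push_cast
  split_ifs with h2
  · rw [min_eq_left (by linarith)]; ring
  · rw [min_eq_right (by linarith)]; ring

theorem plpdm_eq (a : UnitAddCircle) (b : ℝ) (z : UnitAddCircle) :
    plpdm a b z = z + z + (((b / 2) * (4 * ‖z‖ - 1) : ℝ) : UnitAddCircle) + a := by
  rw [plpdm, Sfun_rep, AddCircle.coe_add, two_mul, AddCircle.coe_add, coe_rep]

theorem continuous_plpdm (a : UnitAddCircle) (b : ℝ) : Continuous (plpdm a b) := by
  have : plpdm a b = _ := funext (plpdm_eq a b)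
  rw [this]
  refine ((continuous_id.add continuous_id).add
    ((AddCircle.continuous_mk' 1).comp ?_)).add continuous_const
  fun_prop

theorem semiconj_plLift (A b : ℝ) :
    Function.Semiconj (fun t : ℝ => (t : UnitAddCircle)) (plLift A b) (plpdm A b) := by
  intro t
  simp only [plpdm_eq, plLift, AddCircle.coe_add, two_mul]
  abel

theorem continuous_plLift (A b : ℝ) : Continuous (plLift A b) := by
  have : Continuous fun t : ℝ => ‖(t : UnitAddCircle)‖ :=
    continuous_norm.comp (AddCircle.continuous_mk' 1)
  unfold plLift
  fun_prop

theorem strictMono_plLift (A : ℝ) {b : ℝ} (hb : b ∈ Ico (0 : ℝ) 1) :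
    StrictMono (plLift A b) := by
  intro s t hst
  have h1 : ‖(s : UnitAddCircle)‖ - ‖(t : UnitAddCircle)‖ ≤ t - s := by
    refine (norm_sub_norm_le _ _).trans ?_
    rw [← AddCircle.coe_sub]
    refine (QuotientAddGroup.norm_mk_le_norm (S := AddSubgroup.zmultiples (1 : ℝ))).trans ?_
    rw [Real.norm_eq_abs, abs_sub_comm, abs_of_pos (by linarith)]
  simp only [plLift]
  nlinarith [mul_le_mul_of_nonneg_left h1 hb.1, mul_pos (sub_pos.2 hb.2) (sub_pos.2 hst)]

theorem plLift_add_int (A b t : ℝ) (k : ℤ) : plLift A b (t + k) = plLift A b t + 2 * k := by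
  simp only [plLift, coe_add_intCast]
  ring

theorem iterate_plLift_add_int (A b : ℝ) (n : ℕ) (t : ℝ) (k : ℤ) :
    (plLift A b)^[n] (t + k) = (plLift A b)^[n] t + 2 ^ n * k := by
  induction n generalizing t k with
  | zero => simp
  | succ n ih =>
    have := ih (plLift A b t) (2 * k)
    push_cast at this
    rw [Function.iterate_succ_apply, Function.iterate_succ_apply, plLift_add_int, this]
    ring

theorem concaveOn_plLift (A : ℝ) {b : ℝ} (hb : 0 ≤ b) (k : ℤ) :
    ConcaveOn ℝ (Icc (0 + k : ℝ) (0 + k + 1)) (plLift A b) := by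
  refine ⟨convex_Icc _ _, fun s hs t ht u v hu hv huv => ?_⟩
  have hst := convex_Icc _ _ hs ht hu hv huv
  simp only [zero_add] at hs ht hst
  simp only [plLift, norm_coe_eq_min k hs, norm_coe_eq_min k ht, norm_coe_eq_min k hst]
  simp only [smul_eq_mul]
  have hmin : u * min (s - k) (k + 1 - s) + v * min (t - k) (k + 1 - t) ≤
      min (u * s + v * t - k) (k + 1 - (u * s + v * t)) := by
    obtain rfl : v = 1 - u := by linarith
    refine le_min ?_ ?_
    · nlinarith [mul_le_mul_of_nonneg_left (min_le_left (s - k) (k + 1 - s)) hu,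
        mul_le_mul_of_nonneg_left (min_le_left (t - k) (k + 1 - t)) hv]
    · nlinarith [mul_le_mul_of_nonneg_left (min_le_right (s - k) (k + 1 - s)) hu,
        mul_le_mul_of_nonneg_left (min_le_right (t - k) (k + 1 - t)) hv]
  obtain rfl : v = 1 - u := by linarith
  nlinarith [mul_le_mul_of_nonneg_left hmin hb]

theorem convexOn_plLift (A : ℝ) {b : ℝ} (hb : 0 ≤ b) (k : ℤ) :
    ConvexOn ℝ (Icc (1 / 2 + k : ℝ) (1 / 2 + k + 1)) (plLift A b) := by
  have key : ∀ t ∈ Icc (1 / 2 + k : ℝ) (1 / 2 + k + 1),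
      ‖(t : UnitAddCircle)‖ = |t - (k + 1)| := by
    intro t ht
    have := norm_coe_eq_abs_sub (t := t) (k + 1)
    push_cast at this
    exact this (abs_le.2 ⟨by linarith [ht.1], by linarith [ht.2]⟩)
  refine ⟨convex_Icc _ _, fun s hs t ht u v hu hv huv => ?_⟩
  have hst := convex_Icc _ _ hs ht hu hv huv
  simp only [plLift, key _ hs, key _ ht, key _ hst]
  simp only [smul_eq_mul]
  have habs : |u * s + v * t - (k + 1)| ≤ u * |s - (k + 1)| + v * |t - (k + 1)| := by
    have : u * s + v * t - (k + 1) = u * (s - (k + 1)) + v * (t - (k + 1)) := by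
      linear_combination (k + 1 : ℝ) * huv
    rw [this]
    refine (abs_add_le _ _).trans ?_
    rw [abs_mul, abs_mul, abs_of_nonneg hu, abs_of_nonneg hv]
  obtain rfl : v = 1 - u := by linarith
  nlinarith [mul_le_mul_of_nonneg_left habs hb]

/-- Attraction on the circle to a fixed point of `g` gives attraction on the line to a fixed point
of a lift `G` of `g`, provided that `g` has degree at least two. -/
theorem realBasin_mem_nhds_of_tendsto {g : UnitAddCircle → UnitAddCircle} {G : ℝ → ℝ}
    (hsemi : Function.Semiconj (fun t : ℝ => (t : UnitAddCircle)) G g)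
    (hG : Continuous G) (hmono : StrictMono G) {d : ℝ} (hd : 2 ≤ d)
    (hdeg : ∀ t (k : ℤ), G (t + k) = G t + d * k) {X : ℝ} (hX : G X = X)
    (hatt : ∀ᶠ z in 𝓝 (X : UnitAddCircle), Tendsto (fun k => g^[k] z) atTop (𝓝 X)) :
    realBasin G X ∈ 𝓝 X := by
  have hcoe : ∀ k (t : ℝ), ((G^[k] t : ℝ) : UnitAddCircle) = g^[k] t :=
    fun k t => hsemi.iterate_right k t
  have hcont : Continuous fun t : ℝ => (t : UnitAddCircle) := AddCircle.continuous_mk' 1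
  have hX1 : G (X + 1) = X + d := by simpa [hX] using hdeg X 1
  have hX2 : G (X + 2) = X + d * 2 := by simpa [hX] using hdeg X 2
  obtain ⟨z, hz, hGz⟩ : ∃ z ∈ Ioo X (X + 1), G (G z) - z = 1 := by
    have h2 : X + d * 2 ≤ G (G (X + 1)) := by
      rw [← hX2, hX1]; exact hmono.monotone (by linarith)
    exact intermediate_value_Ioo (f := fun t => G (G t) - t) (by linarith)
      ((hG.comp hG).sub continuous_id).continuousOn
      ⟨by rw [hX, hX]; linarith, by linarith⟩
  have hzne : (z : UnitAddCircle) ≠ X := by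
    intro h
    exact hz.1.ne' ((AddCircle.coe_eq_coe_iff_of_mem_Ico (p := (1 : ℝ)) (a := X)
      ⟨hz.1.le, hz.2⟩ ⟨le_rfl, by linarith⟩).1 h)
  have hzper : Function.IsPeriodicPt g 2 (z : UnitAddCircle) := by
    change g^[2] _ = _
    have h2 : G^[2] z = z + 1 := by
      simp only [Function.iterate_succ_apply, Function.iterate_zero_apply]
      linarith
    rw [← hcoe, h2]
    simp
  have hznot : ¬ Tendsto (fun k => g^[k] (z : UnitAddCircle)) atTop (𝓝 X) := by
    intro h
    refine hzne (tendsto_nhds_unique (f := fun _ : ℕ => (z : UnitAddCircle)) (l := atTop)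
      tendsto_const_nhds ?_)
    refine (h.comp (tendsto_id.const_mul_atTop' (r := 2) (by norm_num))).congr fun k => ?_
    exact hzper.mul_const k
  obtain ⟨ε, hε, hball⟩ := Metric.eventually_nhds_iff_ball.1
    ((hcont.tendsto X).eventually hatt)
  have hfixk : ∀ k, G^[k] X = X := fun k => Function.iterate_fixed hX k
  have hbad : ∀ t ∈ Metric.ball X ε, ∀ k, (G^[k] t : UnitAddCircle) ≠ z := by
    intro t ht k h
    refine hznot ?_
    have h1 := hball t ht
    rw [← tendsto_add_atTop_iff_nat k] at h1
    refine h1.congr fun j => ?_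
    rw [Function.iterate_add_apply, ← hcoe k t, h]
  have hconv := (convex_ball X ε).ordConnected
  have hXb : X ∈ Metric.ball X ε := Metric.mem_ball_self hε
  filter_upwards [Metric.ball_mem_nhds X hε] with y hy
  have hin : ∀ k, G^[k] y ∈ Ioo (z - 1) (z - 1 + 1) := by
    intro k
    constructor
    · by_contra! hle
      have hyX : y ≤ X := by
        by_contra! h
        have := hmono.monotone.iterate k h.le
        rw [hfixk] at this
        linarith [hz.2]
      obtain ⟨t, ht, hte⟩ := intermediate_value_Icc hyX (hG.iterate k).continuousOn
        (show z - 1 ∈ _ from ⟨hle, by rw [hfixk]; linarith [hz.2]⟩)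
      refine hbad t (hconv.out hy hXb ht) k ?_
      rw [hte]; simp
    · by_contra! hle
      have hyX : X ≤ y := by
        by_contra! h
        have := hmono.monotone.iterate k h.le
        rw [hfixk] at this
        linarith [hz.1]
      obtain ⟨t, ht, hte⟩ := intermediate_value_Icc hyX (hG.iterate k).continuousOn
        (show z ∈ _ from ⟨by rw [hfixk]; exact hz.1.le, by linarith⟩)
      exact hbad t (hconv.out hXb hy ht) k (by rw [hte])
  let e := AddCircle.openPartialHomeomorphCoe (1 : ℝ) (z - 1)
  have hXe : X ∈ e.source := ⟨by linarith [hz.2], by linarith [hz.1]⟩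
  have h1 : Tendsto (fun k => e (G^[k] y)) atTop (𝓝 (e X)) :=
    (hball y hy).congr fun k => (hcoe k y).symm
  have h2 := (e.tendsto_symm hXe).comp h1
  exact h2.congr fun k => e.left_inv (hin k)

theorem mem_basin_of_tendsto {f : UnitAddCircle → UnitAddCircle} (hf : Continuous f) {n : ℕ}
    (hn : 0 < n) {x y : UnitAddCircle} (h : Tendsto (fun k => f^[n * k] y) atTop (𝓝 x)) :
    y ∈ basin f (orbitSet f x) := by
  have hr : ∀ r, Tendsto (fun k => Metric.infDist (f^[r] (f^[n * k] y)) (orbitSet f x))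
      atTop (𝓝 0) := by
    intro r
    have h0 : Metric.infDist (f^[r] x) (orbitSet f x) = 0 :=
      Metric.infDist_zero_of_mem ⟨r, rfl⟩
    rw [← h0]
    exact (((Metric.continuous_infDist_pt _).comp (hf.iterate r)).tendsto x).comp h
  refine (nhds_basis_abs_sub_lt (0 : ℝ)).tendsto_right_iff.2 fun ε hε => ?_
  have hall : ∀ᶠ k in atTop, ∀ r ∈ Finset.range n,
      |Metric.infDist (f^[r] (f^[n * k] y)) (orbitSet f x) - 0| < ε :=
    (Finset.eventually_all _).2 fun r _ =>
      (nhds_basis_abs_sub_lt (0 : ℝ)).tendsto_right_iff.1 (hr r) ε hε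
  filter_upwards [(Nat.tendsto_div_const_atTop hn.ne').eventually hall] with k hk
  have := hk (k % n) (Finset.mem_range.2 (Nat.mod_lt k hn))
  rwa [← Function.iterate_add_apply, Nat.mod_add_div] at this

theorem iterate_mem_basin {f : UnitAddCircle → UnitAddCircle} {O : Set UnitAddCircle}
    {y : UnitAddCircle} (h : y ∈ basin f O) (i : ℕ) : f^[i] y ∈ basin f O := by
  simp only [basin, mem_ofPred_eq, ← Function.iterate_add_apply] at h ⊢
  exact (tendsto_add_atTop_iff_nat (f := fun k => Metric.infDist (f^[k] y) O) i).2 h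

theorem stmt3 (a : UnitAddCircle) (b : ℝ) (h : (a, b) ∈ hypSet)
    (n : ℕ) (x : UnitAddCircle) (hx : IsAttractingPeriodicPt (plpdm a b) n x) :
    (0 : UnitAddCircle) ∈ immBasin (plpdm a b) (orbitSet (plpdm a b) x) ∧
    (((1:ℝ)/2 : ℝ) : UnitAddCircle) ∈ immBasin (plpdm a b) (orbitSet (plpdm a b) x) := by
  have hb : b ∈ Ico (0 : ℝ) 1 := h.1
  obtain ⟨hn, hper, -, U, hU, -, hxU, -, hatt⟩ := hx
  obtain ⟨A, rfl⟩ := QuotientAddGroup.mk_surjective a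
  obtain ⟨X, rfl⟩ := QuotientAddGroup.mk_surjective x
  change (plpdm (A : UnitAddCircle) b)^[n] (X : UnitAddCircle) = X at hper
  set f := plpdm (A : UnitAddCircle) b with hf
  set F := plLift A b with hF
  have hsemi : Function.Semiconj (fun t : ℝ => (t : UnitAddCircle)) F f := semiconj_plLift A b
  have hFc : Continuous F := continuous_plLift A b
  have hFm : StrictMono F := strictMono_plLift A hb
  obtain ⟨m, hm⟩ : ∃ m : ℤ, F^[n] X = X + m := by
    have h1 : ((F^[n] X : ℝ) : UnitAddCircle) = X := (hsemi.iterate_right n X).trans hper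
    rw [← sub_eq_zero, ← AddCircle.coe_sub, AddCircle.coe_eq_zero_iff] at h1
    obtain ⟨m, hm⟩ := h1
    rw [zsmul_one] at hm
    exact ⟨m, by linarith⟩
  set G : ℝ → ℝ := fun t => F^[n] t - m with hG
  have hGsemi : Function.Semiconj (fun t : ℝ => (t : UnitAddCircle)) G f^[n] := by
    intro t
    simp only [hG, AddCircle.coe_sub, coe_intCast_eq_zero, sub_zero]
    exact hsemi.iterate_right n t
  have hGc : Continuous G := (hFc.iterate n).sub continuous_const
  have hGm : StrictMono G := fun s t hst => sub_lt_sub_right (hFm.iterate n hst) _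
  have hW : realBasin G X ∈ 𝓝 X := by
    refine realBasin_mem_nhds_of_tendsto hGsemi hGc hGm (d := 2 ^ n) ?_ ?_ ?_ ?_
    · exact le_self_pow₀ one_le_two hn.ne'
    · intro t k
      simp only [hG, hF, iterate_plLift_add_int]; ring
    · simp [hG, hm]
    · filter_upwards [hU.mem_nhds hxU] with z hz
      simpa only [Function.iterate_mul] using hatt z hz
  have hWbasin : ∀ y ∈ realBasin G X, (y : UnitAddCircle) ∈ basin f (orbitSet f X) := by
    intro y hy
    refine mem_basin_of_tendsto (continuous_plpdm _ b) hn ?_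
    refine (((AddCircle.continuous_mk' 1).tendsto X).comp hy).congr fun k => ?_
    rw [Function.iterate_mul]
    exact hGsemi.iterate_right k y
  have himm : ∀ i, ∀ y ∈ realBasin G X,
      ((F^[i] y : ℝ) : UnitAddCircle) ∈ immBasin f (orbitSet f X) := by
    intro i y hy
    have hcoe : ∀ t : ℝ, ((F^[i] t : ℝ) : UnitAddCircle) = f^[i] t := hsemi.iterate_right i
    have hpre : IsPreconnected ((fun t : ℝ => ((F^[i] t : ℝ) : UnitAddCircle)) ''
        realBasin G X) :=
      (ordConnected_realBasin hGm.monotone X).isPreconnected.image _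
        ((AddCircle.continuous_mk' 1).comp (hFc.iterate i)).continuousOn
    refine mem_biUnion (show f^[i] (X : UnitAddCircle) ∈ orbitSet f X from ⟨i, rfl⟩) ?_
    refine hpre.subset_connectedComponentIn ⟨X, mem_of_mem_nhds hW, hcoe X⟩ ?_
      (mem_image_of_mem _ hy)
    rintro _ ⟨t, ht, rfl⟩
    simp only [hcoe]
    exact iterate_mem_basin (hWbasin t ht) i
  constructor
  · obtain ⟨i, y, hy, k, hk⟩ := exists_iterate_mem_of_concaveOn hFc hFm 0
      (concaveOn_plLift A hb.1) n m X hm hW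
    have := himm i y hy
    rw [hk, coe_add_intCast] at this
    simpa using this
  · obtain ⟨i, y, hy, k, hk⟩ := exists_iterate_mem_of_convexOn hFc hFm (1 / 2)
      (convexOn_plLift A hb.1) n m X hm hW
    have := himm i y hy
    rw [hk, coe_add_intCast] at this
    exact this
end

section
/- For every (a,b) ∈ ℝ/ℤ × [0,1], there is a unique continuous map φ_{a,b} : ℝ/ℤ → ℝ/ℤ whose lift is Φ_{a,b} (i.e. φ_{a,b}(x mod 1) = Φ_{a,b}(x) mod 1), and φ_{a,b} semiconjugates f_{a,b} with the doubling map: φ_{a,b} ∘ f_{a,b} = D ∘ φ_{a,b}. -/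
open Set Filter Topology

theorem rep_coe (x : ℝ) : rep (x : UnitAddCircle) = Int.fract x :=
  (AddCircle.coe_equivIco_mk_apply 1 x).trans (by simp)

theorem Sfun_eq (t : ℝ) : Sfun t = 1 - |4 * t - 2| := by
  unfold Sfun
  split_ifs with h
  · rw [abs_of_nonpos (by linarith)]; ring
  · rw [abs_of_nonneg (by linarith)]; ring

/-- The difference between the lift `F_{a,b}` and `x ↦ 2x`. -/
noncomputable def liftDev (a : UnitAddCircle) (b : ℝ) (x : ℝ) : ℝ :=
  liftF a b x - 2 * x

theorem liftDev_eq (a : UnitAddCircle) (b x : ℝ) :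
    liftDev a b x = (b / 2) * Sfun (Int.fract x)
      + (rep a + (if rep a - b / 2 < 0 then 1 else 0)) := by
  have h := Int.fract_add_floor x
  unfold liftDev liftF
  linear_combination 2 * h

theorem continuous_liftDev (a : UnitAddCircle) (b : ℝ) : Continuous (liftDev a b) := by
  have hS : Continuous fun x : ℝ => Sfun (Int.fract x) := by
    refine ContinuousOn.comp_fract'' (f := Sfun) ?_ ?_
    · rw [funext Sfun_eq]
      fun_prop
    · norm_num [Sfun_eq]
  rw [funext (liftDev_eq a b)]
  exact (hS.const_mul _).add continuous_const

theorem continuous_liftF (a : UnitAddCircle) (b : ℝ) : Continuous (liftF a b) := by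
  have h : liftF a b = fun x => liftDev a b x + 2 * x := by
    funext x
    simp [liftDev]
  rw [h]
  exact (continuous_liftDev a b).add (by fun_prop)

theorem exists_norm_liftDev_le (a : UnitAddCircle) (b : ℝ) :
    ∃ C : ℝ, ∀ x, ‖liftDev a b x‖ ≤ C := by
  obtain ⟨C, hC⟩ := (isCompact_Icc (a := (0 : ℝ)) (b := 1)).exists_bound_of_continuousOn
    (continuous_liftDev a b).continuousOn
  refine ⟨C, fun x => ?_⟩
  have h := hC (Int.fract x) ⟨Int.fract_nonneg x, (Int.fract_lt_one x).le⟩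
  rwa [liftDev_eq, Int.fract_fract, ← liftDev_eq] at h

theorem liftF_iterate_div_eq (a : UnitAddCircle) (b x : ℝ) (n : ℕ) :
    (liftF a b)^[n] x / 2 ^ n =
      x + ∑ k ∈ Finset.range n, liftDev a b ((liftF a b)^[k] x) / 2 ^ (k + 1) := by
  induction n with
  | zero => simp
  | succ n ih =>
    rw [Finset.sum_range_succ, ← add_assoc, ← ih, Function.iterate_succ_apply', liftDev]
    field_simp
    ring

theorem exists_summable_bound (a : UnitAddCircle) (b : ℝ) :
    ∃ u : ℕ → ℝ, Summable u ∧
      ∀ n x, ‖liftDev a b ((liftF a b)^[n] x) / 2 ^ (n + 1)‖ ≤ u n := by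
  obtain ⟨C, hC⟩ := exists_norm_liftDev_le a b
  refine ⟨fun n => C / 2 / 2 ^ n, summable_geometric_two' C, fun n x => ?_⟩
  beta_reduce
  rw [norm_div, div_div, ← pow_succ', norm_pow, Real.norm_ofNat]
  exact div_le_div_of_nonneg_right (hC _) (by positivity)

theorem tendsto_liftF_iterate_div (a : UnitAddCircle) (b x : ℝ) :
    Tendsto (fun n : ℕ => (liftF a b)^[n] x / 2 ^ n) atTop
      (𝓝 (x + ∑' n, liftDev a b ((liftF a b)^[n] x) / 2 ^ (n + 1))) := by
  obtain ⟨u, hu, hb⟩ := exists_summable_bound a b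
  simp only [liftF_iterate_div_eq]
  exact ((hu.of_norm_bounded fun n => hb n x).hasSum.tendsto_sum_nat).const_add x

theorem tendsto_Phi (a : UnitAddCircle) (b x : ℝ) :
    Tendsto (fun n : ℕ => (liftF a b)^[n] x / 2 ^ n) atTop (𝓝 (Phi a b x)) :=
  tendsto_nhds_limUnder ⟨_, tendsto_liftF_iterate_div a b x⟩

theorem continuous_Phi (a : UnitAddCircle) (b : ℝ) : Continuous (Phi a b) := by
  obtain ⟨u, hu, hb⟩ := exists_summable_bound a b
  rw [funext fun x => tendsto_nhds_unique (tendsto_Phi a b x) (tendsto_liftF_iterate_div a b x)]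
  exact continuous_id.add (continuous_tsum (fun n => ((continuous_liftDev a b).comp
    ((continuous_liftF a b).iterate n)).div_const _) hu hb)

theorem liftF_add_intCast (a : UnitAddCircle) (b x : ℝ) (m : ℤ) :
    liftF a b (x + m) = liftF a b x + 2 * m := by
  unfold liftF
  rw [Int.fract_add_intCast, Int.floor_add_intCast]
  push_cast
  ring

theorem liftF_iterate_add_one (a : UnitAddCircle) (b x : ℝ) (n : ℕ) :
    (liftF a b)^[n] (x + 1) = (liftF a b)^[n] x + 2 ^ n := by
  induction n with
  | zero => simp
  | succ n ih =>
    rw [Function.iterate_succ_apply', Function.iterate_succ_apply', ih]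
    have h := liftF_add_intCast a b ((liftF a b)^[n] x) (2 ^ n)
    push_cast at h
    rw [h, pow_succ']

theorem Phi_add_one (a : UnitAddCircle) (b x : ℝ) : Phi a b (x + 1) = Phi a b x + 1 := by
  refine tendsto_nhds_unique (tendsto_Phi a b (x + 1)) ?_
  refine ((tendsto_Phi a b x).add_const 1).congr fun n => ?_
  rw [liftF_iterate_add_one, add_div, div_self (by positivity)]

theorem Phi_liftF (a : UnitAddCircle) (b x : ℝ) : Phi a b (liftF a b x) = 2 * Phi a b x := by
  refine tendsto_nhds_unique (tendsto_Phi a b (liftF a b x)) ?_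
  refine (((tendsto_add_atTop_iff_nat 1).2 (tendsto_Phi a b x)).const_mul 2).congr fun n => ?_
  rw [Function.iterate_succ_apply, pow_succ]
  field_simp

theorem plpdm_coe (a : UnitAddCircle) (b x : ℝ) :
    plpdm a b (x : UnitAddCircle) = ((liftF a b x : ℝ) : UnitAddCircle) := by
  have hint (m : ℤ) : (((m : ℤ) : ℝ) : UnitAddCircle) = 0 :=
    (AddCircle.coe_eq_zero_iff 1).2 ⟨m, by simp⟩
  have h : liftF a b x = 2 * Int.fract x + b / 2 * Sfun (Int.fract x) + rep a
      + (((if rep a - b / 2 < 0 then 1 else 0) + 2 * ⌊x⌋ : ℤ) : ℝ) := by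
    unfold liftF
    push_cast
    ring
  rw [h, AddCircle.coe_add, hint, add_zero, AddCircle.coe_add, coe_rep, plpdm, rep_coe]

theorem stmt5 (a : UnitAddCircle) (b : ℝ) (hb : b ∈ Set.Icc (0:ℝ) 1) :
    ∃! φ : UnitAddCircle → UnitAddCircle, Continuous φ ∧
      (∀ x : ℝ, φ ((x : ℝ) : UnitAddCircle) = ((Phi a b x : ℝ) : UnitAddCircle)) ∧
      φ ∘ plpdm a b = Dbl ∘ φ := by
  have hper : Function.Periodic (fun x => ((Phi a b x : ℝ) : UnitAddCircle)) 1 := fun x => by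
    simp only [Phi_add_one, AddCircle.coe_add, AddCircle.coe_period, add_zero]
  have hlift (x : ℝ) : hper.lift (x : UnitAddCircle) = ((Phi a b x : ℝ) : UnitAddCircle) :=
    hper.lift_coe x
  refine ⟨hper.lift, ⟨?_, hlift, ?_⟩, ?_⟩
  · exact continuous_quot_lift _ ((AddCircle.continuous_mk' 1).comp (continuous_Phi a b))
  · funext z
    induction z using QuotientAddGroup.induction_on with
    | H x =>
      simp only [Function.comp_apply]
      rw [plpdm_coe, hlift, hlift, Phi_liftF, two_mul, AddCircle.coe_add, Dbl]
  · rintro ψ ⟨-, hψ, -⟩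
    funext z
    induction z using QuotientAddGroup.induction_on with
    | H x => exact (hψ x).trans (hlift x).symm
end
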